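/- There exists a universal constant C > 0 with the following property. Let k ≥ 2 be an integer, let ε > 0 be real, and set t = (2k−1)(1+ε). Let H be a connected weighted graph on n vertices whose weighted girth is strictly greater than t+1, let Z be a minimum spanning tree of H, and assume every edge of H has weight at most w(Z). Let v_1, …, v_n be any enumeration of the vertices of H and set L = Σ_{i=2}^{n} d_Z(v_{i−1}, v_i). Then for every integer i ≥ 1, the set E_i = { e ∈ E(H) ∖ E(Z) : k^{i−1}·L/n < w(e) ≤ k^{i}·L/n } satisfies w(E_i) ≤ C · L · (n/k^{i−1})^{1/k} / ε^{1+1/k}. -/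

import Mathlib

open SimpleGraph

/-- The weight of a walk: the sum of the weights of its edges. -/
noncomputable def walkWeight {V : Type} {G : SimpleGraph V} (w : Sym2 V → NNReal)
    {u v : V} (p : G.Walk u v) : ENNReal :=
  (p.edges.map (fun e => (w e : ENNReal))).sum

/-- The weighted shortest-path distance: the infimum over all `u`–`v` walks of their
weight (`∞` if no walk exists). -/
noncomputable def wdist {V : Type} (G : SimpleGraph V) (w : Sym2 V → NNReal)
    (u v : V) : ENNReal :=
  ⨅ p : G.Walk u v, walkWeight w p

/-- `H` is a `t`-spanner of `G` (with the inherited weights `w`):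
`d_H(u,v) ≤ t · d_G(u,v)` for all vertices `u, v`. -/
def IsTSpanner {V : Type} (G H : SimpleGraph V) (w : Sym2 V → NNReal) (t : ℝ) : Prop :=
  ∀ u v : V, wdist H w u v ≤ ENNReal.ofReal t * wdist G w u v

/-- The total weight of a graph: the sum of the weights of all its edges. -/
noncomputable def totalWeight {V : Type} [Fintype V] (G : SimpleGraph V)
    (w : Sym2 V → NNReal) : ℝ :=
  ∑ e ∈ G.edgeSet.toFinite.toFinset, (w e : ℝ)

/-- The weight of a minimum spanning tree of a connected graph `G`. -/
noncomputable def mstWeight {V : Type} [Fintype V] (G : SimpleGraph V)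
    (w : Sym2 V → NNReal) : ℝ :=
  sInf {x | ∃ T : SimpleGraph V, T ≤ G ∧ T.IsTree ∧ x = totalWeight T w}

/-- Dart `b` may follow dart `a` in a non-backtracking walk. -/
def NonBacktracking {α β : Type*} (src : α → β) (rev : α → α) (a b : α) : Prop :=
  src (rev a) = src b ∧ b ≠ rev a

section Moore

variable {α β : Type*} {src : α → β} {rev : α → α}

theorem eq_of_isChain_nonBacktracking (hrev : Function.Involutive rev) {D : Finset α} {n : ℕ}
    (hD : ∀ d ∈ D, rev d ∈ D)
    (hq : ∀ (q : List α) (h : q ≠ []), q.length ≤ 2 * n → (∀ d ∈ q, d ∈ D) →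
      q.IsChain (NonBacktracking src rev) → src (q.head h) ≠ src (rev (q.getLast h)))
    (l l' : List α) (d : α) (hl : l.length ≤ n) (hll : l'.length = l.length)
    (hlD : ∀ x ∈ l, x ∈ D) (hlD' : ∀ x ∈ l', x ∈ D)
    (hc : (d :: l).IsChain (NonBacktracking src rev))
    (hc' : (d :: l').IsChain (NonBacktracking src rev))
    (he : src (rev ((d :: l).getLast (by simp))) = src (rev ((d :: l').getLast (by simp)))) :
    l = l' := by
  induction l generalizing d l' with
  | nil => simpa [eq_comm] using hll
  | cons a r ih =>
    obtain _ | ⟨a', r'⟩ := l'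
    · simp at hll
    rw [List.isChain_cons_cons] at hc hc'
    by_cases haa : a = a'
    · subst haa
      rw [ih r' a (by simp at hl; omega) (by simpa using hll)
        (fun x hx => hlD x (by simp [hx])) (fun x hx => hlD' x (by simp [hx])) hc.2 hc'.2
        (by simpa using he)]
    · exfalso
      refine hq (((a' :: r').map rev).reverse ++ (a :: r)) (by simp) ?_ ?_ ?_ ?_
      · simp at hl hll ⊢; omega
      · intro x hx
        rw [List.mem_append, List.mem_reverse, List.mem_map] at hx
        obtain ⟨y, hy, rfl⟩ | hx := hx
        · exact hD _ (hlD' _ hy)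
        · exact hlD _ hx
      · rw [List.isChain_append]
        refine ⟨?_, hc.2, ?_⟩
        · rw [List.isChain_reverse, List.isChain_map]
          refine hc'.2.imp fun x y hxy => ⟨?_, ?_⟩
          · simpa [hrev y] using hxy.1.symm
          · simpa [hrev y] using hxy.2.symm
        · intro x hx y hy
          simp at hx hy
          subst hx hy
          refine ⟨?_, ?_⟩
          · rw [hrev, ← hc.1.1, ← hc'.1.1]
          · rwa [hrev]
      · rw [List.head_append_of_ne_nil (by simp), List.head_reverse, List.getLast_map,
          List.getLast_append_of_right_ne_nil _ _ (by simp)]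
        simpa using he.symm

theorem exists_finset_nonBacktracking [DecidableEq α] [DecidableEq β]
    {D : Finset α} (hD : ∀ d ∈ D, rev d ∈ D) {m : ℕ}
    (hdeg : ∀ d ∈ D, m + 1 ≤ (D.filter fun x => src x = src d).card) (n : ℕ) (d : α) (hd : d ∈ D) :
    ∃ F : Finset (List α), m ^ n ≤ F.card ∧ ∀ l ∈ F, l.length = n ∧ (∀ x ∈ l, x ∈ D) ∧
      (d :: l).IsChain (NonBacktracking src rev) := by
  induction n generalizing d with
  | zero => exact ⟨{[]}, by simp, by simp⟩
  | succ n ih =>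
    choose! F hF hFl using ih
    set T := (D.filter fun x => src x = src (rev d)).erase (rev d) with hT
    have hTD : ∀ x ∈ T, x ∈ D := fun x hx => (Finset.mem_filter.1 (Finset.mem_of_mem_erase hx)).1
    refine ⟨T.biUnion fun x => (F x).image (List.cons x), ?_, ?_⟩
    · rw [Finset.card_biUnion]
      · have hTc : m ≤ T.card := by
          have := hdeg _ (hD d hd)
          rw [hT, Finset.card_erase_of_mem (by simp [hD d hd])]
          omega
        calc m ^ (n + 1) = m * m ^ n := by ring
          _ ≤ T.card * m ^ n := Nat.mul_le_mul_right _ hTc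
          _ = ∑ _x ∈ T, m ^ n := by simp
          _ ≤ _ := Finset.sum_le_sum fun x hx => by
            rw [Finset.card_image_of_injective _ (List.cons_injective)]
            exact hF x (hTD x hx)
      · intro x _ y _ hxy
        rw [Function.onFun, Finset.disjoint_left]
        simp only [Finset.mem_image]
        rintro _ ⟨l, -, rfl⟩ ⟨l', -, h⟩
        exact hxy (List.cons.inj h).1.symm
    · intro l hl
      simp only [Finset.mem_biUnion, Finset.mem_image] at hl
      obtain ⟨x, hx, l, hl, rfl⟩ := hl
      obtain ⟨h1, h2, h3⟩ := hFl x (hTD x hx) l hl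
      refine ⟨by simp [h1], by simpa [hTD x hx] using h2, List.isChain_cons_cons.2 ⟨?_, h3⟩⟩
      simp only [hT, Finset.mem_erase, Finset.mem_filter] at hx
      exact ⟨hx.2.2.symm, hx.1⟩

theorem exists_subset_min_degree [DecidableEq α] [DecidableEq β] (hrev : Function.Involutive rev)
    {D : Finset α} (hD : ∀ d ∈ D, rev d ∈ D) {m : ℕ} {B : Finset β}
    (hB : ∀ d ∈ D, src d ∈ B) (hcard : 2 * m * B.card < D.card) :
    ∃ D' ⊆ D, D'.Nonempty ∧ (∀ d ∈ D', rev d ∈ D') ∧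
      ∀ d ∈ D', m ≤ (D'.filter fun x => src x = src d).card := by
  set E : Finset β → Finset α := fun S => D.filter fun d => src d ∈ S ∧ src (rev d) ∈ S with hE
  obtain ⟨S, hS, hmax⟩ := Finset.exists_max_image B.powerset
    (fun S => ((E S).card : ℤ) - 2 * m * S.card) ⟨B, by simp⟩
  have hEB : E B = D := Finset.filter_true_of_mem fun d hd => ⟨hB d hd, hB _ (hD d hd)⟩
  refine ⟨E S, Finset.filter_subset _ _, ?_, ?_, ?_⟩
  · rw [← Finset.card_pos]
    have := hmax B (by simp)
    rw [hEB] at this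
    have h2 : (2 * m * B.card : ℤ) < D.card := by exact_mod_cast hcard
    have h3 : (0 : ℤ) ≤ 2 * m * S.card := by positivity
    have : (0 : ℤ) < (E S).card := by linarith
    exact_mod_cast this
  · intro d hd
    simp only [hE, Finset.mem_filter] at hd ⊢
    exact ⟨hD d hd.1, hd.2.2, by rw [hrev]; exact hd.2.1⟩
  · intro d hd
    simp only [hE, Finset.mem_filter] at hd
    set A := (E S).filter fun x => src x = src d with hA
    have hsub : E S ⊆ E (S.erase (src d)) ∪ (A ∪ A.image rev) := by
      intro x hx
      have hx' := hx
      simp only [hE, Finset.mem_filter] at hx'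
      by_cases h1 : src x = src d
      · simp [hA, hx, h1]
      by_cases h2 : src (rev x) = src d
      · have : rev x ∈ A := by
          simp only [hA, hE, Finset.mem_filter]
          exact ⟨⟨hD x hx'.1, hx'.2.2, by rw [hrev]; exact hx'.2.1⟩, h2⟩
        simp only [Finset.mem_union]
        exact Or.inr (Or.inr (Finset.mem_image.2 ⟨_, this, hrev x⟩))
      · simp only [hE, Finset.mem_union, Finset.mem_filter, Finset.mem_erase]
        exact Or.inl ⟨hx'.1, ⟨h1, hx'.2.1⟩, h2, hx'.2.2⟩
    have h1 : (E S).card ≤ (E (S.erase (src d))).card + (A.card + A.card) :=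
      (Finset.card_le_card hsub).trans <| (Finset.card_union_le _ _).trans <|
        Nat.add_le_add_left ((Finset.card_union_le _ _).trans <|
          Nat.add_le_add_left Finset.card_image_le _) _
    have h2 := hmax (S.erase (src d))
      (Finset.mem_powerset.2 ((Finset.erase_subset _ _).trans (Finset.mem_powerset.1 hS)))
    have h3 : (S.erase (src d)).card + 1 = S.card := Finset.card_erase_add_one hd.2.1
    rw [← h3] at h2
    push_cast at h2
    have h1' : ((E S).card : ℤ) ≤ (E (S.erase (src d))).card + (A.card + A.card) := by
      exact_mod_cast h1
    have : (m : ℤ) ≤ A.card := by linarith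
    exact_mod_cast this

/-- The Moore bound for multigraphs given by a set of darts: if there are no short closed
non-backtracking walks, then there are few darts. -/
theorem card_darts_le (hrev : Function.Involutive rev)
    {D : Finset α} (hD : ∀ d ∈ D, rev d ∈ D) {B : Finset β} (hB : ∀ d ∈ D, src d ∈ B)
    {k : ℕ} (hk : k ≠ 0)
    (hq : ∀ (q : List α) (h : q ≠ []), q.length ≤ 2 * k → (∀ d ∈ q, d ∈ D) →
      q.IsChain (NonBacktracking src rev) → src (q.head h) ≠ src (rev (q.getLast h))) :
    (D.card : ℝ) ≤ 6 * (B.card : ℝ) ^ (1 + 1 / (k : ℝ)) := by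
  classical
  obtain rfl | hBne := B.eq_empty_or_nonempty
  · have : D = ∅ := Finset.eq_empty_of_forall_notMem fun d hd => by simpa using hB d hd
    rw [this]; simp; positivity
  set m := ⌊(B.card : ℝ) ^ (1 / (k : ℝ))⌋₊ + 1 with hm
  have hB1 : (1 : ℝ) ≤ B.card := by exact_mod_cast hBne.card_pos
  have hroot : (1 : ℝ) ≤ (B.card : ℝ) ^ (1 / (k : ℝ)) := Real.one_le_rpow hB1 (by positivity)
  have hle : D.card ≤ 2 * (m + 1) * B.card := by
    by_contra! hlt
    obtain ⟨D', hsub, ⟨d, hd⟩, hD', hdeg⟩ := exists_subset_min_degree hrev hD hB hlt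
    obtain ⟨F, hF, hFl⟩ := exists_finset_nonBacktracking (src := src) hD' hdeg k d hd
    have hinj : F.card ≤ B.card := by
      refine Finset.card_le_card_of_injOn
        (fun l => src (rev ((d :: l).getLast (by simp)))) ?_ ?_
      · intro l hl
        refine hB _ (hD _ (hsub ?_))
        have := List.getLast_mem (l := d :: l) (by simp)
        rw [List.mem_cons] at this
        obtain h | h := this
        · rw [h]; exact hd
        · exact (hFl l hl).2.1 _ h
      · intro l hl l' hl' he
        obtain ⟨h1, h2, h3⟩ := hFl l hl
        obtain ⟨h1', h2', h3'⟩ := hFl l' hl'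
        exact eq_of_isChain_nonBacktracking hrev hD hq l l' d h1.le (h1'.trans h1.symm)
          (fun x hx => hsub (h2 x hx)) (fun x hx => hsub (h2' x hx)) h3 h3' he
    have h1 : (B.card : ℝ) ^ (1 / (k : ℝ)) < m := by
      rw [hm]; push_cast; exact Nat.lt_floor_add_one _
    have h2 : (B.card : ℝ) < (m : ℝ) ^ k := by
      calc (B.card : ℝ) = ((B.card : ℝ) ^ (1 / (k : ℝ))) ^ k := by
            rw [one_div, Real.rpow_inv_natCast_pow (by positivity) hk]
        _ < _ := pow_lt_pow_left₀ h1 (by positivity) hk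
    have h3 : B.card < m ^ k := by exact_mod_cast h2
    omega
  have hm' : (m : ℝ) ≤ (B.card : ℝ) ^ (1 / (k : ℝ)) + 1 := by
    rw [hm]; push_cast
    have := Nat.floor_le (zero_le_one.trans hroot)
    linarith
  rw [Real.rpow_add (by positivity), Real.rpow_one]
  calc (D.card : ℝ) ≤ 2 * (m + 1) * B.card := by exact_mod_cast hle
    _ ≤ 2 * (3 * (B.card : ℝ) ^ (1 / (k : ℝ))) * B.card := by gcongr; linarith
    _ = _ := by ring

end Moore

section ShortSegment

variable {V : Type*}

/-- The darts of the shifted graph: the `s`-th copy of `u → v` starts at `P u + s`. -/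
def shiftSrc (P : V → ℕ) (d : (V × V) × ℕ) : ℕ := P d.1.1 + d.2

/-- The reversal of a shifted dart. -/
def shiftRev (d : (V × V) × ℕ) : (V × V) × ℕ := (d.1.swap, d.2)

theorem shiftRev_involutive : Function.Involutive (shiftRev (V := V)) := fun _ => rfl

/-- The edge underlying a shifted dart. -/
def shiftEdge (d : (V × V) × ℕ) : Sym2 V := s(d.1.1, d.1.2)

theorem nodup_or_exists_segment (P : V → ℕ) (K : ℕ) (q : List ((V × V) × ℕ))
    (hc : q.IsChain (NonBacktracking (shiftSrc P) shiftRev)) (hK : ∀ d ∈ q, d.2 ≤ K) :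
    (q.map shiftEdge).Nodup ∨ ∃ (r : List ((V × V) × ℕ)) (h : r ≠ []), r <:+: q ∧
      (r.map shiftEdge).Nodup ∧ P (r.head h).1.1 ≤ P (r.getLast h).1.2 + 2 * K ∧
      P (r.getLast h).1.2 ≤ P (r.head h).1.1 + 2 * K := by
  induction q with
  | nil => simp
  | cons a q ih =>
    obtain hnd | ⟨r, h, hr, h'⟩ := ih hc.tail fun d hd => hK d (by simp [hd])
    swap
    · exact Or.inr ⟨r, h, hr.trans (List.suffix_cons a q).isInfix, h'⟩
    by_cases ha : shiftEdge a ∈ q.map shiftEdge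
    swap
    · exact Or.inl (by simpa using ⟨by simpa using ha, hnd⟩)
    right
    obtain ⟨b, hb, hab⟩ := List.mem_map.1 ha
    obtain ⟨l₁, l₂, rfl⟩ := List.append_of_mem hb
    have hKa := hK a (by simp)
    have hKb := hK b (by simp)
    obtain hab | hab : b.1 = a.1 ∨ b.1 = a.1.swap := by
      simpa [shiftEdge, Prod.ext_iff] using hab
    · refine ⟨l₁ ++ [b], by simp, ⟨[a], l₂, by simp⟩, ?_, ?_⟩
      · refine hnd.sublist (List.Sublist.map _ ?_)
        simp
      · have hh : shiftSrc P (shiftRev a) = shiftSrc P ((l₁ ++ [b]).head (by simp)) := by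
          obtain _ | ⟨c, l₁⟩ := l₁
          · simpa using (List.isChain_cons_cons.1 hc).1.1
          · simpa using (List.isChain_cons_cons.1 hc).1.1
        have hKh := hK ((l₁ ++ [b]).head (by simp)) (by
          refine List.mem_cons_of_mem _ (List.Sublist.subset ?_ (List.head_mem _))
          simp)
        simp only [shiftSrc, shiftRev, Prod.fst_swap] at hh
        rw [List.getLast_append_singleton, hab]
        omega
    · have hne : l₁ ≠ [] := by
        rintro rfl
        have h := (List.isChain_cons_cons.1 hc).1
        refine h.2 (Prod.ext hab ?_)
        have := h.1
        simp only [shiftSrc, shiftRev, hab] at this ⊢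
        omega
      refine ⟨l₁, hne, ⟨[a], b :: l₂, by simp⟩, ?_, ?_⟩
      · exact hnd.sublist (List.Sublist.map _ (by simp))
      · have h1 : shiftSrc P (shiftRev a) = shiftSrc P (l₁.head hne) := by
          obtain _ | ⟨c, l₁⟩ := l₁
          · exact absurd rfl hne
          · simpa using (List.isChain_cons_cons.1 hc).1.1
        have h2 : shiftSrc P (shiftRev (l₁.getLast hne)) = shiftSrc P b := by
          have := (List.isChain_append.1 hc.tail).2.2 (l₁.getLast hne)
            (List.getLast_mem_getLast? hne) b (by simp)
          exact this.1
        have hK1 := hK (l₁.head hne) (by simp)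
        have hK2 := hK (l₁.getLast hne) (by simp)
        simp only [shiftSrc, shiftRev, Prod.fst_swap, hab] at h1 h2
        omega

theorem exists_segment (P : V → ℕ) (K : ℕ) (q : List ((V × V) × ℕ)) (hq : q ≠ [])
    (hc : q.IsChain (NonBacktracking (shiftSrc P) shiftRev)) (hK : ∀ d ∈ q, d.2 ≤ K)
    (hclosed : shiftSrc P (q.head hq) = shiftSrc P (shiftRev (q.getLast hq))) :
    ∃ (r : List ((V × V) × ℕ)) (h : r ≠ []), r <:+: q ∧
      (r.map shiftEdge).Nodup ∧ P (r.head h).1.1 ≤ P (r.getLast h).1.2 + 2 * K ∧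
      P (r.getLast h).1.2 ≤ P (r.head h).1.1 + 2 * K := by
  obtain h | h := nodup_or_exists_segment P K q hc hK
  · refine ⟨q, hq, List.infix_refl q, h, ?_⟩
    have h1 := hK _ (List.head_mem hq)
    have h2 := hK _ (List.getLast_mem hq)
    simp only [shiftSrc, shiftRev, Prod.fst_swap] at hclosed
    omega
  · exact h

end ShortSegment

section ShortCycle

variable {V : Type} {H : SimpleGraph V} {w : Sym2 V → NNReal} {f : Sym2 V} {u v x : V}
  {a b c : ℝ}

/-- `v` can be reached from `u` by a walk of weight at most `a` that avoids the edge `f`. -/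
def ReachAvoiding (H : SimpleGraph V) (w : Sym2 V → NNReal) (f : Sym2 V) (u v : V) (a : ℝ) :
    Prop :=
  ∃ p : H.Walk u v, f ∉ p.edges ∧ (p.edges.map fun e => (w e : ℝ)).sum ≤ a

theorem ReachAvoiding.trans (h : ReachAvoiding H w f u v a) (h' : ReachAvoiding H w f v x b) :
    ReachAvoiding H w f u x (a + b) := by
  obtain ⟨p, hp, hpw⟩ := h
  obtain ⟨q, hq, hqw⟩ := h'
  refine ⟨p.append q, by simp [hp, hq], ?_⟩
  rw [Walk.edges_append, List.map_append, List.sum_append]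
  exact add_le_add hpw hqw

theorem ReachAvoiding.mono (h : ReachAvoiding H w f u v a) (hab : a ≤ b) :
    ReachAvoiding H w f u v b := by
  obtain ⟨p, hp, hpw⟩ := h
  exact ⟨p, hp, hpw.trans hab⟩

theorem reachAvoiding_refl : ReachAvoiding H w f u u 0 := ⟨Walk.nil, by simp, by simp⟩

theorem reachAvoiding_of_adj (h : H.Adj u v) (hf : s(u, v) ≠ f) :
    ReachAvoiding H w f u v (w s(u, v)) :=
  ⟨h.toWalk, by simpa using hf.symm, by simp⟩

theorem sum_map_bypass_edges_le [DecidableEq V] (w : Sym2 V → NNReal) (p : H.Walk u v) :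
    (p.bypass.edges.map fun e => (w e : ℝ)).sum ≤ (p.edges.map fun e => (w e : ℝ)).sum := by
  obtain ⟨l, hl, hs⟩ := List.subperm_of_subset p.bypass_isPath.isTrail.edges_nodup
    p.edges_bypass_subset_edges
  rw [← (hl.map _).sum_eq]
  refine (hs.map _).sum_le_sum fun y hy => ?_
  obtain ⟨e, -, rfl⟩ := List.mem_map.1 hy
  positivity

theorem lt_add_of_reachAvoiding {T : ℝ}
    (hgirth : ∀ (v : V) (p : H.Walk v v), p.IsCycle → ∀ e ∈ p.edges,
      T * (w e : ℝ) < (p.edges.map fun e => (w e : ℝ)).sum)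
    (huv : H.Adj u v) (h : ReachAvoiding H w s(u, v) v u a) :
    T * (w s(u, v) : ℝ) < w s(u, v) + a := by
  classical
  obtain ⟨p, hp, hpw⟩ := h
  have hcyc : (Walk.cons huv p.bypass).IsCycle :=
    (Walk.cons_isCycle_iff _ _).2 ⟨p.bypass_isPath, fun h => hp (p.edges_bypass_subset_edges h)⟩
  have := hgirth u _ hcyc s(u, v) (by simp)
  simp only [Walk.edges_cons, List.map_cons, List.sum_cons] at this
  linarith [sum_map_bypass_edges_le w p]

theorem reachAvoiding_getLast (l : List (V × V)) (d : V × V)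
    (hadj : ∀ y ∈ l, H.Adj y.1 y.2) (hf : ∀ y ∈ l, s(y.1, y.2) ≠ f)
    (hc : (d :: l).IsChain fun y z => ReachAvoiding H w f y.2 z.1 a) :
    ReachAvoiding H w f d.2 ((d :: l).getLast (by simp)).2
      ((l.map fun y => (w s(y.1, y.2) : ℝ)).sum + l.length * a) := by
  induction l generalizing d with
  | nil => simpa using reachAvoiding_refl
  | cons y l ih =>
    rw [List.isChain_cons_cons] at hc
    have := (hc.1.trans (reachAvoiding_of_adj (hadj y (by simp)) (hf y (by simp)))).trans
      (ih y (fun z hz => hadj z (by simp [hz])) (fun z hz => hf z (by simp [hz])) hc.2)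
    rw [List.getLast_cons (by simp)]
    refine this.mono (le_of_eq ?_)
    simp
    ring

theorem reachAvoiding_head (l : List (V × V)) (d : V × V)
    (hadj : ∀ y ∈ l, H.Adj y.1 y.2) (hf : ∀ y ∈ l, s(y.1, y.2) ≠ f)
    (hc : (l ++ [d]).IsChain fun y z => ReachAvoiding H w f y.2 z.1 a) :
    ReachAvoiding H w f ((l ++ [d]).head (by simp)).1 d.1
      ((l.map fun y => (w s(y.1, y.2) : ℝ)).sum + l.length * a) := by
  induction l with
  | nil => simpa using reachAvoiding_refl
  | cons y l ih =>
    have h1 : ReachAvoiding H w f y.2 ((l ++ [d]).head (by simp)).1 a := by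
      obtain _ | ⟨z, l⟩ := l
      · exact (List.isChain_cons_cons.1 hc).1
      · exact (List.isChain_cons_cons.1 hc).1
    have := ((reachAvoiding_of_adj (hadj y (by simp)) (hf y (by simp))).trans h1).trans
      (ih (fun z hz => hadj z (by simp [hz])) (fun z hz => hf z (by simp [hz])) hc.tail)
    refine this.mono (le_of_eq ?_)
    simp
    ring

/-- A closed sequence of distinct edges, joined by connections avoiding the edge `d` of the
sequence, contains a cycle through `d`. -/
theorem lt_of_closed_sequence {T : ℝ}
    (hgirth : ∀ (v : V) (p : H.Walk v v), p.IsCycle → ∀ e ∈ p.edges,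
      T * (w e : ℝ) < (p.edges.map fun e => (w e : ℝ)).sum)
    (r : List (V × V)) (hr : r ≠ []) (hadj : ∀ y ∈ r, H.Adj y.1 y.2)
    (hnd : (r.map fun y => s(y.1, y.2)).Nodup) (d : V × V) (hd : d ∈ r)
    (hc : r.IsChain fun y z => ReachAvoiding H w s(d.1, d.2) y.2 z.1 a)
    (hclose : ReachAvoiding H w s(d.1, d.2) (r.getLast hr).2 (r.head hr).1 b) :
    T * (w s(d.1, d.2) : ℝ) <
      (r.map fun y => (w s(y.1, y.2) : ℝ)).sum + ((r.length : ℝ) - 1) * a + b := by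
  obtain ⟨l₁, l₂, rfl⟩ := List.append_of_mem hd
  rw [List.map_append, List.map_cons, List.nodup_middle, List.nodup_cons, ← List.map_append] at hnd
  have hne : ∀ y ∈ l₁ ++ l₂, s(y.1, y.2) ≠ s(d.1, d.2) := fun y hy h =>
    hnd.1 (List.mem_map.2 ⟨y, hy, h⟩)
  have h2 := reachAvoiding_getLast l₂ d (fun y hy => hadj y (by simp [hy]))
    (fun y hy => hne y (by simp [hy])) (List.isChain_append.1 hc).2.1
  have h1 := reachAvoiding_head l₁ d (fun y hy => hadj y (by simp [hy]))
    (fun y hy => hne y (by simp [hy])) (hc.prefix ⟨l₂, by simp⟩)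
  rw [List.getLast_append_of_right_ne_nil _ _ (by simp)] at hclose
  have hhead : (l₁ ++ d :: l₂).head hr = (l₁ ++ [d]).head (by simp) := by
    cases l₁ <;> rfl
  rw [hhead] at hclose
  have := lt_add_of_reachAvoiding hgirth (hadj d hd) ((h2.trans hclose).trans h1)
  simp only [List.map_append, List.map_cons, List.sum_append, List.sum_cons, List.length_append,
    List.length_cons]
  push_cast
  linarith

end ShortCycle

section Tour

variable {V : Type} {Z : SimpleGraph V}

theorem toReal_walkWeight (w : Sym2 V → NNReal) {u v : V} (p : Z.Walk u v) :
    (walkWeight w p).toReal = (p.edges.map fun e => (w e : ℝ)).sum := by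
  unfold walkWeight
  have h : ∀ l : List (Sym2 V), (l.map fun e => (w e : ENNReal)).sum =
      (((l.map w).sum : NNReal) : ENNReal) := by
    intro l
    induction l <;> simp_all
  have h' : ∀ l : List (Sym2 V), (l.map fun e => (w e : ℝ)).sum =
      (((l.map w).sum : NNReal) : ℝ) := by
    intro l
    induction l <;> simp_all
  rw [h, h', ENNReal.coe_toReal]

theorem exists_walk_le_wdist (hZ : Z.IsTree) (w : Sym2 V → NNReal) (u v : V) :
    ∃ p : Z.Walk u v, (p.edges.map fun e => (w e : ℝ)).sum ≤ (wdist Z w u v).toReal := by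
  classical
  obtain ⟨p₀⟩ := hZ.connected.preconnected u v
  refine ⟨p₀.bypass, ?_⟩
  have htop : ∀ q : Z.Walk u v, walkWeight w q ≠ ⊤ := by
    intro q
    unfold walkWeight
    induction q.edges <;> simp_all
  rw [← toReal_walkWeight]
  refine ENNReal.toReal_mono ?_ (le_iInf fun q => ?_)
  · exact ne_top_of_le_ne_top (htop p₀) (iInf_le _ p₀)
  · have h : p₀.bypass = q.bypass := congrArg Subtype.val <|
      (hZ.isAcyclic.subsingleton_path u v).elim
        ⟨p₀.bypass, p₀.bypass_isPath⟩ ⟨q.bypass, q.bypass_isPath⟩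
    rw [← ENNReal.toReal_le_toReal (htop _) (htop _), h,
      toReal_walkWeight, toReal_walkWeight]
    exact sum_map_bypass_edges_le w q

/-- The vertices of a tour can be placed on an interval of the length of the tour without
contracting any distance. -/
theorem exists_position (hZ : Z.IsTree) (w : Sym2 V → NNReal) (a : V) (l : List V)
    (hl : (a :: l).Nodup) :
    ∃ pos : V → ℝ, pos a = 0 ∧ ∀ x ∈ a :: l,
      (0 ≤ pos x ∧ pos x ≤
        (((a :: l).zip (a :: l).tail).map fun p => (wdist Z w p.1 p.2).toReal).sum) ∧
      ∀ y ∈ a :: l,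
        ∃ p : Z.Walk x y, (p.edges.map fun e => (w e : ℝ)).sum ≤ |pos x - pos y| := by
  classical
  induction l generalizing a with
  | nil =>
    refine ⟨fun _ => 0, rfl, ?_⟩
    simp only [List.mem_singleton]
    rintro x rfl
    refine ⟨by simp, ?_⟩
    rintro y rfl
    exact ⟨Walk.nil, by simp⟩
  | cons b l ih =>
    obtain ⟨pos, hb, hpos⟩ := ih b hl.tail
    have hab : ∀ x ∈ b :: l, x ≠ a := by
      rintro x hx rfl
      exact (List.nodup_cons.1 hl).1 hx
    set δ := (wdist Z w a b).toReal with hδ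
    have hδ0 : 0 ≤ δ := ENNReal.toReal_nonneg
    have hfrom : ∀ x ∈ b :: l,
        ∃ p : Z.Walk a x, (p.edges.map fun e => (w e : ℝ)).sum ≤ δ + pos x := by
      intro x hx
      obtain ⟨p, hp⟩ := exists_walk_le_wdist hZ w a b
      obtain ⟨q, hq⟩ := (hpos b (by simp)).2 x hx
      refine ⟨p.append q, ?_⟩
      rw [hb, zero_sub, abs_neg, abs_of_nonneg (hpos x hx).1.1] at hq
      rw [Walk.edges_append, List.map_append, List.sum_append]
      exact add_le_add hp hq
    refine ⟨fun x => if x = a then 0 else δ + pos x, by simp, ?_⟩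
    intro x hx
    simp only [List.tail_cons, List.zip_cons_cons, List.map_cons, List.sum_cons, ← hδ]
    rw [List.mem_cons] at hx
    obtain rfl | hx := hx
    · refine ⟨⟨by simp, ?_⟩, ?_⟩
      · have := (hpos b (by simp)).1
        simp only [List.tail_cons] at this
        simp
        linarith
      · intro y hy
        rw [List.mem_cons] at hy
        obtain rfl | hy := hy
        · exact ⟨Walk.nil, by simp⟩
        · obtain ⟨p, hp⟩ := hfrom y hy
          refine ⟨p, ?_⟩
          rwa [if_pos rfl, if_neg (hab y hy), zero_sub, abs_neg,
            abs_of_nonneg (add_nonneg hδ0 (hpos y hy).1.1)]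
    · have h1 := (hpos x hx).1
      simp only [List.tail_cons] at h1
      rw [if_neg (hab x hx)]
      refine ⟨⟨by linarith, by linarith⟩, ?_⟩
      intro y hy
      rw [List.mem_cons] at hy
      obtain rfl | hy := hy
      · obtain ⟨p, hp⟩ := hfrom x hx
        refine ⟨p.reverse, ?_⟩
        rw [if_pos rfl, sub_zero, abs_of_nonneg (by linarith), Walk.edges_reverse,
          List.map_reverse, List.sum_reverse]
        exact hp
      · rw [if_neg (hab y hy), add_sub_add_left_eq_sub]
        exact (hpos x hx).2 y hy

end Tour

section Main

variable {V : Type} {H Z : SimpleGraph V} {w : Sym2 V → NNReal}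

theorem abs_sub_le_of_floor {x y η : ℝ} (hη : 0 < η) (hx : 0 ≤ x) (hy : 0 ≤ y) {m : ℝ}
    (h₁ : (⌊x / η⌋₊ : ℝ) ≤ ⌊y / η⌋₊ + m) (h₂ : (⌊y / η⌋₊ : ℝ) ≤ ⌊x / η⌋₊ + m) :
    |x - y| ≤ η * (m + 1) := by
  have a1 := Nat.floor_le (div_nonneg hx hη.le)
  have a2 := Nat.floor_le (div_nonneg hy hη.le)
  have a3 := Nat.lt_floor_add_one (x / η)
  have a4 := Nat.lt_floor_add_one (y / η)
  rw [abs_le]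
  have hxy : x - y = η * (x / η - y / η) := by field_simp
  rw [hxy, ← mul_neg_one, mul_assoc]
  constructor <;> refine mul_le_mul_of_nonneg_left ?_ hη.le <;> linarith

theorem shift_head_ne_getLast {k : ℕ} (hk : 2 ≤ k) {ε : ℝ} (hε : 0 < ε) {W : ℝ} (hW : 0 < W)
    (hgirth : ∀ (v : V) (p : H.Walk v v), p.IsCycle → ∀ e ∈ p.edges,
      ((2 * (k : ℝ) - 1) * (1 + ε) + 1) * (w e : ℝ) < (p.edges.map fun e => (w e : ℝ)).sum)
    (hZH : Z ≤ H) {pos : V → ℝ} (hpos : ∀ x, 0 ≤ pos x)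
    (hwalk : ∀ x y, ∃ p : Z.Walk x y, (p.edges.map fun e => (w e : ℝ)).sum ≤ |pos x - pos y|)
    (q : List ((V × V) × ℕ)) (hq : q ≠ []) (hlen : q.length ≤ 2 * k)
    (hqE : ∀ d ∈ q, H.Adj d.1.1 d.1.2 ∧ ¬ Z.Adj d.1.1 d.1.2 ∧ W ≤ w s(d.1.1, d.1.2) ∧
      (d.2 : ℝ) ≤ w s(d.1.1, d.1.2) / W ∧ d.2 ≤ k)
    (hc : q.IsChain (NonBacktracking (shiftSrc fun v => ⌊pos v / (ε * W / 5)⌋₊) shiftRev)) :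
    shiftSrc (fun v => ⌊pos v / (ε * W / 5)⌋₊) (q.head hq) ≠
      shiftSrc (fun v => ⌊pos v / (ε * W / 5)⌋₊) (shiftRev (q.getLast hq)) := by
  classical
  intro hclosed
  set η := ε * W / 5 with hη
  have hη0 : 0 < η := by positivity
  obtain ⟨r, hr, hrq, hnd, hd1, hd2⟩ := exists_segment (fun v => ⌊pos v / η⌋₊) k q hq hc
    (fun d hd => (hqE d hd).2.2.2.2) hclosed
  have hrE := fun d hd => hqE d (hrq.subset hd)
  have hrc := hc.infix hrq
  obtain ⟨d, hd, hmax⟩ := Finset.exists_max_image r.toFinset (fun d => w s(d.1.1, d.1.2))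
    ⟨_, List.mem_toFinset.2 (List.head_mem hr)⟩
  rw [List.mem_toFinset] at hd
  set M : ℝ := (w s(d.1.1, d.1.2) : ℝ) with hM
  have hmax' : ∀ y ∈ r, (w s(y.1.1, y.1.2) : ℝ) ≤ M := fun y hy =>
    NNReal.coe_le_coe.2 (hmax y (List.mem_toFinset.2 hy))
  have hWM : W ≤ M := (hrE d hd).2.2.1
  have hreach : ∀ x y b, |pos x - pos y| ≤ b → ReachAvoiding H w s(d.1.1, d.1.2) x y b := by
    intro x y b hb
    obtain ⟨p, hp⟩ := hwalk x y
    refine ⟨p.mapLe hZH, ?_, ?_⟩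
    · rw [Walk.edges_mapLe_eq_edges]
      exact fun h => (hrE d hd).2.1 (Walk.adj_of_mem_edges p h)
    · rw [Walk.edges_mapLe_eq_edges]
      exact hp.trans hb
  have hfin := lt_of_closed_sequence hgirth (r.map Prod.fst) (by simpa using hr)
    (a := η * (M / W + 1)) (b := η * (2 * k + 1))
    (by
      intro y hy
      obtain ⟨z, hz, rfl⟩ := List.mem_map.1 hy
      exact (hrE z hz).1)
    (by rw [List.map_map]; exact hnd) d.1 (List.mem_map_of_mem hd)
    (by
      rw [List.isChain_map]
      refine (List.isChain_iff_forall_rel_of_append_cons_cons.2 ?_)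
      intro y z l₁ l₂ hl
      have hyz : y ∈ r ∧ z ∈ r := by simp [hl]
      have hrel := (List.isChain_iff_forall_rel_of_append_cons_cons.1 hrc hl).1
      have hs : ∀ x ∈ r, (x.2 : ℝ) ≤ M / W := fun x hx =>
        (hrE x hx).2.2.2.1.trans (by gcongr; exact hmax' x hx)
      have hy := hs y hyz.1
      have hz := hs z hyz.2
      have hrel' : ((⌊pos y.1.2 / η⌋₊ : ℕ) : ℝ) + y.2 = (⌊pos z.1.1 / η⌋₊ : ℕ) + z.2 := by
        exact_mod_cast hrel
      have hy0 : (0 : ℝ) ≤ y.2 := by positivity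
      have hz0 : (0 : ℝ) ≤ z.2 := by positivity
      exact hreach _ _ _ (abs_sub_le_of_floor hη0 (hpos _) (hpos _) (by linarith) (by linarith)))
    (by
      rw [List.getLast_map, List.head_map]
      exact hreach _ _ _ (abs_sub_le_of_floor hη0 (hpos _) (hpos _) (by exact_mod_cast hd2)
        (by exact_mod_cast hd1)))
  rw [List.map_map, List.length_map, ← hM] at hfin
  have hsum : (r.map ((fun y : V × V => (w s(y.1, y.2) : ℝ)) ∘ Prod.fst)).sum ≤ r.length * M := by
    have := List.sum_le_card_nsmul (r.map ((fun y : V × V => (w s(y.1, y.2) : ℝ)) ∘ Prod.fst)) M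
      (by
        intro x hx
        obtain ⟨y, hy, rfl⟩ := List.mem_map.1 hx
        exact hmax' y hy)
    simpa using this
  have hrlen : (r.length : ℝ) ≤ 2 * k := by exact_mod_cast hrq.length_le.trans hlen
  have hM0 : 0 < M := hW.trans_le hWM
  have hk' : (2 : ℝ) ≤ k := by exact_mod_cast hk
  have hstep : η * (M / W + 1) ≤ 2 / 5 * ε * M := by
    have : η * (M / W + 1) = ε / 5 * (M + W) := by rw [hη]; field_simp
    rw [this]
    nlinarith
  have h1 : (r.length : ℝ) * M ≤ 2 * k * M := by gcongr
  have h2 : ((r.length : ℝ) - 1) * (η * (M / W + 1)) ≤ (2 * k - 1) * (2 / 5 * ε * M) := by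
    calc _ ≤ (2 * (k : ℝ) - 1) * (η * (M / W + 1)) := by gcongr
      _ ≤ _ := by gcongr; linarith
  have h3 : η * (2 * k + 1) ≤ ε * M / 5 * (2 * k + 1) := by rw [hη]; gcongr
  have h4 : ε * M * 2 ≤ ε * M * k := by gcongr
  nlinarith

theorem sum_div_le_card [Fintype V] [DecidableEq V] (E : Finset (Sym2 V)) {k : ℕ} {W : ℝ}
    (hW : 0 < W) (hE : ∀ e ∈ E, (w e : ℝ) ≤ k * W) :
    (∑ e ∈ E, (w e : ℝ)) / W ≤
      ((((Finset.univ : Finset (V × V)) ×ˢ Finset.range (k + 1)).filter fun d =>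
        s(d.1.1, d.1.2) ∈ E ∧ (d.2 : ℝ) ≤ w s(d.1.1, d.1.2) / W).card : ℝ) := by
  rw [Finset.card_eq_sum_card_fiberwise (f := shiftEdge) (t := E)
    (fun d hd => (Finset.mem_filter.1 hd).2.1), Finset.sum_div]
  push_cast
  refine Finset.sum_le_sum fun e he => ?_
  have hfl : (w e : ℝ) / W ≤ ((Finset.range (⌊(w e : ℝ) / W⌋₊ + 1)).card : ℝ) := by
    rw [Finset.card_range]
    push_cast
    exact (Nat.lt_floor_add_one _).le
  refine hfl.trans (Nat.cast_le.2 ?_)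
  have hout : s((Quot.out e).1, (Quot.out e).2) = e := Quot.out_eq e
  refine Finset.card_le_card_of_injOn (fun s => (Quot.out e, s)) ?_ ?_
  · intro s hs
    have hs' : (s : ℝ) ≤ (w e : ℝ) / W := by
      rw [Finset.coe_range, Set.mem_Iio, Nat.lt_succ_iff] at hs
      exact (Nat.le_floor_iff (by positivity)).1 hs
    have hsk : s ≤ k := by
      have : (s : ℝ) ≤ k := hs'.trans ((div_le_iff₀ hW).2 (hE e he))
      exact_mod_cast this
    rw [Finset.mem_coe, Finset.mem_filter, Finset.mem_filter, Finset.mem_product]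
    simp only [Finset.mem_univ, true_and, Finset.mem_range, shiftEdge, hout]
    exact ⟨⟨by omega, he, hs'⟩, trivial⟩
  · intro s _ s' _ h
    exact (Prod.ext_iff.1 h).2

theorem sum_weight_le [Fintype V] {k : ℕ} (hk : 2 ≤ k) {ε : ℝ} (hε : 0 < ε) {W L : ℝ}
    (hW : 0 < W)
    (hgirth : ∀ (v : V) (p : H.Walk v v), p.IsCycle → ∀ e ∈ p.edges,
      ((2 * (k : ℝ) - 1) * (1 + ε) + 1) * (w e : ℝ) < (p.edges.map fun e => (w e : ℝ)).sum)
    (hZH : Z ≤ H) {pos : V → ℝ} (hpos : ∀ x, 0 ≤ pos x) (hposL : ∀ x, pos x ≤ L)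
    (hwalk : ∀ x y, ∃ p : Z.Walk x y, (p.edges.map fun e => (w e : ℝ)).sum ≤ |pos x - pos y|)
    (hL : (2 * (k : ℝ) - 1) * (1 + ε) * W ≤ L)
    (E : Finset (Sym2 V)) (hEH : ∀ e ∈ E, e ∈ H.edgeSet \ Z.edgeSet)
    (hEW : ∀ e ∈ E, W ≤ w e ∧ w e ≤ k * W) :
    ∑ e ∈ E, (w e : ℝ) ≤ 216 * W * (L / (ε * W)) ^ (1 + 1 / (k : ℝ)) := by
  classical
  set η := ε * W / 5 with hη
  have hk' : (2 : ℝ) ≤ k := by exact_mod_cast hk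
  have hη0 : 0 < η := by positivity
  have hL0 : 0 ≤ L := le_trans (by
    have : (0 : ℝ) ≤ 2 * (k : ℝ) - 1 := by linarith
    positivity) hL
  set D : Finset ((V × V) × ℕ) := ((Finset.univ : Finset (V × V)) ×ˢ Finset.range (k + 1)).filter
    fun d => s(d.1.1, d.1.2) ∈ E ∧ (d.2 : ℝ) ≤ w s(d.1.1, d.1.2) / W with hD
  have hDmem : ∀ d ∈ D, d.2 ≤ k ∧ s(d.1.1, d.1.2) ∈ E ∧
      (d.2 : ℝ) ≤ w s(d.1.1, d.1.2) / W := by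
    intro d hd
    simpa [hD, Nat.lt_succ_iff] using hd
  have hcard := card_darts_le (src := shiftSrc fun v => ⌊pos v / η⌋₊) shiftRev_involutive (D := D)
    (B := Finset.range (⌊L / η⌋₊ + k + 1)) (k := k)
    (by
      intro d hd
      have := hDmem d hd
      rw [hD, Finset.mem_filter]
      simp only [shiftRev, Prod.fst_swap, Prod.snd_swap, Sym2.eq_swap (a := d.1.2)]
      exact ⟨by simpa [Nat.lt_succ_iff] using this.1, this.2⟩)
    (by
      intro d hd
      have h1 := (hDmem d hd).1
      have h2 : ⌊pos d.1.1 / η⌋₊ ≤ ⌊L / η⌋₊ := Nat.floor_mono (by gcongr; exact hposL _)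
      simp only [shiftSrc, Finset.mem_range]
      omega)
    (by omega)
    (fun q hq hlen hqD hc => shift_head_ne_getLast hk hε hW hgirth hZH hpos hwalk q hq hlen
      (fun d hd => by
        obtain ⟨h1, h2, h3⟩ := hDmem d (hqD d hd)
        have h4 := hEH _ h2
        exact ⟨h4.1, h4.2, (hEW _ h2).1, h3, h1⟩) hc)
  have hlow := sum_div_le_card (w := w) E (k := k) hW fun e he => (hEW e he).2
  set X := L / (ε * W) with hX
  have hXk : (k : ℝ) + 1 ≤ X := by
    rw [hX, le_div_iff₀ (by positivity)]
    nlinarith [mul_pos hε hW, mul_le_mul_of_nonneg_right hk' (mul_pos hε hW).le]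
  have hX0 : 0 < X := by linarith
  have hN : ((Finset.range (⌊L / η⌋₊ + k + 1)).card : ℝ) ≤ 6 * X := by
    have h1 := Nat.floor_le (div_nonneg hL0 hη0.le)
    have h2 : L / η = 5 * X := by rw [hη, hX]; field_simp
    rw [Finset.card_range]
    push_cast
    linarith
  have h6 : (6 : ℝ) ^ (1 + 1 / (k : ℝ)) ≤ 36 := by
    calc (6 : ℝ) ^ (1 + 1 / (k : ℝ)) ≤ 6 ^ (2 : ℝ) := by
          refine Real.rpow_le_rpow_of_exponent_le (by norm_num) ?_
          have : 1 / (k : ℝ) ≤ 1 := (div_le_one (by linarith)).2 (by linarith)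
          linarith
      _ = 36 := by norm_num
  have hfin : (∑ e ∈ E, (w e : ℝ)) / W ≤ 216 * X ^ (1 + 1 / (k : ℝ)) :=
    calc _ ≤ _ := hlow
      _ ≤ _ := hcard
      _ ≤ 6 * (6 * X) ^ (1 + 1 / (k : ℝ)) := by gcongr
      _ = 6 * (6 ^ (1 + 1 / (k : ℝ)) * X ^ (1 + 1 / (k : ℝ))) := by
        rw [Real.mul_rpow (by norm_num) hX0.le]
      _ ≤ 6 * (36 * X ^ (1 + 1 / (k : ℝ))) := by gcongr
      _ = _ := by ring
  rw [div_le_iff₀ hW] at hfin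
  linarith

end Main

/-- **Main technical theorem.** There is a universal constant `C > 0` with the following
property. Let `k ≥ 2` be an integer, `ε > 0`, and `t = (2k-1)(1+ε)`. Let `H` be a
connected weighted graph on `n` vertices whose weighted girth is strictly greater than
`t + 1` (equivalently, every cycle `C` satisfies `w(C) > (t+1)·w(e)` for every edge
`e ∈ C`), let `Z` be a minimum spanning tree of `H`, and assume every edge of `H` has
weight at most `w(Z)`. For any enumeration `v_1, …, v_n` of the vertices of `H` (given
as a duplicate-free list containing every vertex), set
`L = Σ_{i=2}^n d_Z(v_{i-1}, v_i)`. Then for every integer `i ≥ 1`, the edge set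
`E_i = { e ∈ E(H) \ E(Z) : k^{i-1}·L/n < w(e) ≤ k^i·L/n }` satisfies
`w(E_i) ≤ C · L · (n/k^{i-1})^{1/k} / ε^{1+1/k}`. -/
theorem weight_bound_per_scale :
    ∃ C : ℝ, 0 < C ∧
      ∀ (k : ℕ), 2 ≤ k → ∀ (ε : ℝ), 0 < ε →
        ∀ (V : Type) [Fintype V] (H Z : SimpleGraph V) (w : Sym2 V → NNReal),
          H.Connected → (∀ e ∈ H.edgeSet, 0 < w e) →
          -- weighted girth of `H` exceeds `t + 1`, where `t = (2k-1)(1+ε)`: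
          (∀ (v : V) (p : H.Walk v v), p.IsCycle → ∀ e ∈ p.edges,
            ((2 * (k : ℝ) - 1) * (1 + ε) + 1) * (w e : ℝ) <
              (p.edges.map fun e => (w e : ℝ)).sum) →
          -- `Z` is a minimum spanning tree of `H`:
          Z ≤ H → Z.IsTree → totalWeight Z w = mstWeight H w →
          -- every edge of `H` has weight at most `w(Z)`:
          (∀ e ∈ H.edgeSet, (w e : ℝ) ≤ totalWeight Z w) →
          -- an arbitrary enumeration of the vertices:
          ∀ l : List V, l.Nodup → (∀ x : V, x ∈ l) →
            ∀ L : ℝ,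
              L = ((l.zip l.tail).map fun p => (wdist Z w p.1 p.2).toReal).sum →
              ∀ i : ℕ, 1 ≤ i →
                ∑ e ∈ {e ∈ H.edgeSet \ Z.edgeSet |
                        (k : ℝ) ^ (i - 1) * L / (Fintype.card V : ℝ) < (w e : ℝ) ∧
                        (w e : ℝ) ≤ (k : ℝ) ^ i * L / (Fintype.card V : ℝ)}.toFinite.toFinset,
                    (w e : ℝ) ≤
                  C * L * ((Fintype.card V : ℝ) / (k : ℝ) ^ (i - 1)) ^ ((1 : ℝ) / (k : ℝ)) /
                    ε ^ ((1 : ℝ) + 1 / (k : ℝ)) := by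
  refine ⟨216, by norm_num, ?_⟩
  intro k hk ε hε V _ H Z w hH hw hgirth hZH hZ _ _ l hl hmem L hL i hi
  classical
  obtain _ | ⟨a, l⟩ := l
  · obtain ⟨x⟩ := hH.nonempty
    simpa using hmem x
  obtain ⟨pos, -, hpos⟩ := exists_position hZ w a l hl
  rw [← hL] at hpos
  have hwalk : ∀ x y, ∃ p : Z.Walk x y,
      (p.edges.map fun e => (w e : ℝ)).sum ≤ |pos x - pos y| :=
    fun x y => (hpos x (hmem x)).2 y (hmem y)
  have hpos0 : ∀ x, 0 ≤ pos x := fun x => (hpos x (hmem x)).1.1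
  have hposL : ∀ x, pos x ≤ L := fun x => (hpos x (hmem x)).1.2
  have hL0 : 0 ≤ L := (hpos0 a).trans (hposL a)
  have hk' : (2 : ℝ) ≤ k := by exact_mod_cast hk
  have hn : (0 : ℝ) < Fintype.card V := by
    have := hH.nonempty
    exact_mod_cast Fintype.card_pos
  set E := Set.Finite.toFinset _ with hE
  obtain hemp | ⟨e₀, he₀⟩ := E.eq_empty_or_nonempty
  · rw [hemp, Finset.sum_empty]
    positivity
  set W : ℝ := (k : ℝ) ^ (i - 1) * L / Fintype.card V with hW
  have hkW : (k : ℝ) ^ i * L / Fintype.card V = k * W := by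
    obtain ⟨j, rfl⟩ := Nat.exists_eq_add_of_le' hi
    rw [hW, Nat.add_sub_cancel, pow_succ]
    ring
  have hEmem : ∀ e ∈ E, e ∈ H.edgeSet \ Z.edgeSet ∧ W < w e ∧ (w e : ℝ) ≤ k * W := by
    intro e he
    rw [hE, Set.Finite.mem_toFinset] at he
    exact ⟨he.1, he.2.1, hkW ▸ he.2.2⟩
  have hL1 : (2 * (k : ℝ) - 1) * (1 + ε) * w e₀ < L := by
    have h0 := (hEmem e₀ he₀).1
    induction e₀ using Sym2.ind with
    | _ u v =>
      obtain ⟨p, hp⟩ := hwalk v u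
      have habs : |pos v - pos u| ≤ L := abs_sub_le_iff.2
        ⟨by linarith [hposL v, hpos0 u], by linarith [hposL u, hpos0 v]⟩
      have := lt_add_of_reachAvoiding hgirth (show H.Adj u v from h0.1)
        (a := L) ⟨p.mapLe hZH, by
          rw [Walk.edges_mapLe_eq_edges]
          exact fun h => h0.2 (Walk.edges_subset_edgeSet p h), by
          rw [Walk.edges_mapLe_eq_edges]
          exact hp.trans habs⟩
      linarith
  have ht : 0 < (2 * (k : ℝ) - 1) * (1 + ε) := mul_pos (by linarith) (by linarith)
  have hLpos : 0 < L := lt_of_le_of_lt (mul_nonneg ht.le (NNReal.coe_nonneg _)) hL1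
  have hWpos : 0 < W := by positivity
  refine (sum_weight_le hk hε hWpos hgirth hZH hpos0 hposL hwalk ?_ E
    (fun e he => (hEmem e he).1) (fun e he => ⟨(hEmem e he).2.1.le, (hEmem e he).2.2⟩)).trans ?_
  · exact (mul_le_mul_of_nonneg_left (hEmem e₀ he₀).2.1.le ht.le).trans hL1.le
  · have hnk : (Fintype.card V : ℝ) / (k : ℝ) ^ (i - 1) = L / W := by
      rw [hW]
      field_simp
    rw [hnk, show L / (ε * W) = L / W / ε by field_simp,
      Real.div_rpow (by positivity) hε.le, Real.rpow_add (by positivity : 0 < L / W),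
      Real.rpow_one]
    refine le_of_eq ?_
    field_simp
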